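/- arXiv:2401.10557 — 3 statements merged into one kernel-verified Lean document; each statement's English description precedes it below -/
import Mathlib

section
/- Let ν, C₁, N, F be positive real numbers with F ≤ ν²/(9·C₁·N). Let x, y be nonnegative real numbers with y ≤ (3C₁/(2ν))·F. If 2ν·x² ≤ C₁·F·x + N·y²·x + 2N·y·x², then x ≤ (3C₁/(2ν))·F. -/
/-- Induction step in the proof of Lemma 3.1 (stability of Newton's method). -/
theorem stmt_1 (ν C₁ N F x y : ℝ) (hν : 0 < ν) (hC₁ : 0 < C₁) (hN : 0 < N) (hF : 0 < F)
    (hFsmall : F ≤ ν ^ 2 / (9 * C₁ * N))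
    (hx : 0 ≤ x) (hy : 0 ≤ y)
    (hybound : y ≤ (3 * C₁ / (2 * ν)) * F)
    (hineq : 2 * ν * x ^ 2 ≤ C₁ * F * x + N * y ^ 2 * x + 2 * N * y * x ^ 2) :
    x ≤ (3 * C₁ / (2 * ν)) * F := by
  have hB : 0 < (3 * C₁ / (2 * ν)) * F := by positivity
  have hCF : C₁ * F = 2 / 3 * ν * ((3 * C₁ / (2 * ν)) * F) := by field_simp
  have hFN : F * (9 * C₁ * N) ≤ ν ^ 2 := (le_div_iff₀ (by positivity)).1 hFsmall
  set B := (3 * C₁ / (2 * ν)) * F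
  rcases hx.eq_or_lt with rfl | hx
  · exact hB.le
  have hNB : N * B ≤ ν / 6 := by
    refine le_of_mul_le_mul_left ?_ hν
    linear_combination hFN / 6 - 3 / 2 * N * hCF
  have hNy : N * y ≤ ν / 6 := (mul_le_mul_of_nonneg_left hybound hN.le).trans hNB
  have hNyy : N * y * y ≤ ν / 6 * B := mul_le_mul hNy hybound hy (by positivity)
  have hcancel : 2 * ν * x ≤ C₁ * F + N * y * y + 2 * (N * y) * x := by
    refine le_of_mul_le_mul_right ?_ hx
    linear_combination hineq
  have hνx : ν * x ≤ ν * (B / 2) := by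
    linear_combination 3 / 5 * (hcancel + hCF + hNyy + 2 * mul_le_mul_of_nonneg_right hNy hx.le)
  linarith [le_of_mul_le_mul_left hνx hν]
end

section
/- Let ν, C₁, N, F be positive real numbers with F ≤ ν²/(9·C₁·N). Let (x_m)_{m≥0} be a sequence of nonnegative real numbers such that 2ν·x₀ ≤ C₁·F and, for every m ≥ 0, 2ν·x_{m+1}² ≤ C₁·F·x_{m+1} + N·x_m²·x_{m+1} + 2N·x_m·x_{m+1}². Then x_m ≤ (3C₁/(2ν))·F for all m ≥ 0. -/
/-- One step of the Newton recurrence keeps the interval `[0, B]` invariant, where `B` satisfies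
`2 * ν * B = 3 * G` and `6 * N * B ≤ ν`. -/
theorem newton_step_le {ν N G B a b : ℝ} (hν : 0 < ν) (hN : 0 ≤ N) (ha : 0 ≤ a) (hb : 0 ≤ b)
    (hG : 2 * ν * B = 3 * G) (hB : 6 * (N * B) ≤ ν) (hab : a ≤ B)
    (h : 2 * ν * b ^ 2 ≤ G * b + N * a ^ 2 * b + 2 * N * a * b ^ 2) : b ≤ B := by
  rcases hb.eq_or_lt with rfl | hb
  · exact ha.trans hab
  have hdiv : 2 * ν * b ≤ G + N * a ^ 2 + 2 * N * a * b :=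
    le_of_mul_le_mul_right (by linarith) hb
  have hNa : 6 * (N * a) ≤ ν := by
    have := mul_le_mul_of_nonneg_left hab hN
    linarith
  have hquad : 6 * (N * a) * a ≤ ν * B := mul_le_mul hNa hab ha hν.le
  have hcross : 6 * (N * a) * b ≤ ν * b := mul_le_mul_of_nonneg_right hNa hb.le
  have hνb : 0 < ν * b := mul_pos hν hb
  exact le_of_mul_le_mul_left (by linarith) hν

/-- Sequence-level content of Lemma 3.1: uniform stability of the Newton iterates. -/
theorem stmt_2 (ν C₁ N F : ℝ) (hν : 0 < ν) (hC₁ : 0 < C₁) (hN : 0 < N) (hF : 0 < F)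
    (hFsmall : F ≤ ν ^ 2 / (9 * C₁ * N))
    (x : ℕ → ℝ) (hxnn : ∀ m, 0 ≤ x m)
    (h0 : 2 * ν * x 0 ≤ C₁ * F)
    (hrec : ∀ m : ℕ, 2 * ν * (x (m + 1)) ^ 2 ≤
      C₁ * F * x (m + 1) + N * (x m) ^ 2 * x (m + 1) + 2 * N * x m * (x (m + 1)) ^ 2) :
    ∀ m : ℕ, x m ≤ (3 * C₁ / (2 * ν)) * F := by
  have hsmall : F * (9 * C₁ * N) ≤ ν ^ 2 := (le_div_iff₀ (by positivity)).1 hFsmall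
  have hG : 2 * ν * (3 * C₁ / (2 * ν) * F) = 3 * (C₁ * F) := by field_simp
  have hB : 6 * (N * (3 * C₁ / (2 * ν) * F)) ≤ ν := by
    refine le_of_mul_le_mul_left ?_ hν
    calc ν * (6 * (N * (3 * C₁ / (2 * ν) * F)))
        = 3 * N * (2 * ν * (3 * C₁ / (2 * ν) * F)) := by ring
      _ = F * (9 * C₁ * N) := by rw [hG]; ring
      _ ≤ ν * ν := by linarith
  intro m
  induction m with
  | zero =>
    have hCF : 0 < C₁ * F := mul_pos hC₁ hF
    exact le_of_mul_le_mul_left (by linarith) (show 0 < 2 * ν by positivity)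
  | succ m ih => exact newton_step_le hν hN.le (hxnn m) (hxnn (m + 1)) hG hB ih (hrec m)
end

section
/- Let ν, C₁, N, F, α₁, β, γ be positive real numbers with F ≤ ν²/(9·C₁·N), let n ≥ 1 be a natural number, set σ := (3C₁N/(2ν²))·F, and let e, e', u', y, p be nonnegative real numbers satisfying: e ≤ (C₁/ν)·σ^(2ⁿ − 1)·F, e' ≤ (C₁/ν)·σ^(2^(n−1) − 1)·F, u' ≤ (3C₁/(2ν))·F, y ≤ (γ·C₁/(α₁·ν))·σ^(2ⁿ − 1)·F, and β·p ≤ 2ν·e + γ·y + 2N·u'·e + N·e'². Then β·p ≤ (10/3 + γ²/(α₁·ν))·C₁·σ^(2ⁿ − 1)·F. -/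
/-- Pressure error estimate (3.19) of Theorem 3.1, stated as a real-number
inequality. -/
theorem stmt_12 (ν C₁ N F α₁ β γ : ℝ) (hν : 0 < ν) (hC₁ : 0 < C₁) (hN : 0 < N)
    (hF : 0 < F) (hα₁ : 0 < α₁) (hβ : 0 < β) (hγ : 0 < γ)
    (hFsmall : F ≤ ν ^ 2 / (9 * C₁ * N))
    (n : ℕ) (hn : 1 ≤ n)
    (σ : ℝ) (hσ : σ = (3 * C₁ * N / (2 * ν ^ 2)) * F)
    (e e' u' y p : ℝ) (he : 0 ≤ e) (he' : 0 ≤ e') (hu' : 0 ≤ u') (hy : 0 ≤ y) (hp : 0 ≤ p)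
    (hebound : e ≤ (C₁ / ν) * σ ^ (2 ^ n - 1) * F)
    (he'bound : e' ≤ (C₁ / ν) * σ ^ (2 ^ (n - 1) - 1) * F)
    (hu'bound : u' ≤ (3 * C₁ / (2 * ν)) * F)
    (hybound : y ≤ (γ * C₁ / (α₁ * ν)) * σ ^ (2 ^ n - 1) * F)
    (hineq : β * p ≤ 2 * ν * e + γ * y + 2 * N * u' * e + N * e' ^ 2) :
    β * p ≤ (10 / 3 + γ ^ 2 / (α₁ * ν)) * C₁ * σ ^ (2 ^ n - 1) * F := by
  obtain ⟨k, hk, hk'⟩ : ∃ k, 2 ^ (n - 1) - 1 = k ∧ 2 ^ n - 1 = 2 * k + 1 := by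
    obtain ⟨m, rfl⟩ := Nat.exists_eq_add_of_le' hn
    have hpos : 1 ≤ 2 ^ m := Nat.one_le_two_pow
    refine ⟨2 ^ m - 1, by simp, ?_⟩
    rw [pow_succ]
    omega
  rw [hk] at he'bound
  rw [hk'] at hebound hybound ⊢
  have hσ_nonneg : 0 ≤ σ := by rw [hσ]; positivity
  have hσF : N * C₁ * F / ν ^ 2 = 2 / 3 * σ := by
    rw [hσ]
    field_simp
  have hvel : ν * e ≤ C₁ * σ ^ (2 * k + 1) * F := by
    calc ν * e ≤ ν * ((C₁ / ν) * σ ^ (2 * k + 1) * F) := by gcongr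
      _ = C₁ * σ ^ (2 * k + 1) * F := by field_simp
  have hhead : γ * y ≤ γ ^ 2 / (α₁ * ν) * (C₁ * σ ^ (2 * k + 1) * F) := by
    calc γ * y ≤ γ * ((γ * C₁ / (α₁ * ν)) * σ ^ (2 * k + 1) * F) := by gcongr
      _ = γ ^ 2 / (α₁ * ν) * (C₁ * σ ^ (2 * k + 1) * F) := by ring
  have hcoef : 2 * N * u' ≤ ν / 3 := by
    calc 2 * N * u' ≤ 2 * N * ((3 * C₁ / (2 * ν)) * (ν ^ 2 / (9 * C₁ * N))) := by
          gcongr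
          exact hu'bound.trans (by gcongr)
      _ = ν / 3 := by
          field_simp
          norm_num
  have hconv : 2 * N * u' * e ≤ ν / 3 * e := by gcongr
  have hquad : N * e' ^ 2 ≤ 2 / 3 * (C₁ * σ ^ (2 * k + 1) * F) := by
    calc N * e' ^ 2 ≤ N * ((C₁ / ν) * σ ^ k * F) ^ 2 := by gcongr
      _ = C₁ * F * σ ^ (2 * k) * (N * C₁ * F / ν ^ 2) := by ring
      _ = 2 / 3 * (C₁ * σ ^ (2 * k + 1) * F) := by rw [hσF]; ring
  have hnonneg : 0 ≤ C₁ * σ ^ (2 * k + 1) * F := by positivity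
  linarith
end
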